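/- Let u₁, …, u_N and ũ₁, …, ũ_N be two families of solutions of the system u' = (L₀ + V(x))u such that for each j = 1, …, n both e^{−ζ_j x} u_j(x) → p_j and e^{−ζ_j x} ũ_j(x) → p_j as x → −∞, and for each j = n+1, …, N both e^{−ζ_j x} u_j(x) → p_j and e^{−ζ_j x} ũ_j(x) → p_j as x → +∞. Then for every x ∈ ℝ, det{u₁(x), …, u_N(x)} = det{ũ₁(x), …, ũ_N(x)}, where det{w₁, …, w_N} denotes the determinant of the matrix with columns w₁, …, w_N. -/

import Mathlib

open MeasureTheory Filter Topology

noncomputable section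

/-- A (continuous, integrated-sense) solution of the first order system `u' = L(x) u`. -/
def IsSolV (N : ℕ) (L : ℝ → Matrix (Fin N) (Fin N) ℂ) (u : ℝ → Fin N → ℂ) : Prop :=
  Continuous u ∧ ∀ x₀ x : ℝ, u x = u x₀ + ∫ y in x₀..x, (L y).mulVec (u y)

theorem absolutelyContinuousOnInterval_intervalIntegral_complex {f : ℝ → ℂ}
    (h : ∀ a b, IntervalIntegrable f volume a b) (a b : ℝ) :
    AbsolutelyContinuousOnInterval (fun x ↦ ∫ v in a..x, f v) a b := by
  have hre (a b : ℝ) : IntervalIntegrable (fun x => (f x).re) volume a b :=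
    ⟨(h a b).1.re, (h a b).2.re⟩
  have him (a b : ℝ) : IntervalIntegrable (fun x => (f x).im) volume a b :=
    ⟨(h a b).1.im, (h a b).2.im⟩
  have h1 := ((hre a b).absolutelyContinuousOnInterval_intervalIntegral
    Set.left_mem_uIcc).smul
    (g := fun _ => (1 : ℂ)) contDiffOn_const.absolutelyContinuousOnInterval
  have h2 := ((him a b).absolutelyContinuousOnInterval_intervalIntegral
    Set.left_mem_uIcc).smul
    (g := fun _ => Complex.I) contDiffOn_const.absolutelyContinuousOnInterval
  convert! h1.add h2 using 1
  funext x
  have e1 := Complex.reCLM.intervalIntegral_comp_comm (h a x)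
  have e2 := Complex.imCLM.intervalIntegral_comp_comm (h a x)
  simp only [Complex.reCLM_apply, Complex.imCLM_apply] at e1 e2
  simp [e1, e2, Complex.re_add_im]

theorem exp_mul_eq_add_integral {f h : ℝ → ℂ} {z : ℂ} (hf : Continuous f)
    (hh : ∀ a b, IntervalIntegrable h volume a b)
    (hsol : ∀ x₀ x, f x = f x₀ + ∫ y in x₀..x, (z * f y + h y)) (y x : ℝ) :
    Complex.exp (-z * x) * f x = Complex.exp (-z * y) * f y +
      ∫ s in y..x, Complex.exp (-z * s) * h s := by
  have hg (a b : ℝ) : IntervalIntegrable (fun s => z * f s + h s) volume a b :=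
    ((continuous_const.mul hf).intervalIntegrable a b).add (hh a b)
  have he : Continuous fun s : ℝ => Complex.exp (-z * s) := by fun_prop
  have hk (a b : ℝ) : IntervalIntegrable (fun s : ℝ => Complex.exp (-z * s) * h s) volume a b :=
    (hh a b).continuousOn_mul he.continuousOn
  have hfac : AbsolutelyContinuousOnInterval f y x := by
    have h1 := absolutelyContinuousOnInterval_intervalIntegral_complex hg y x
    have h2 := (AbsolutelyContinuousOnInterval.add (f := fun _ => f y)
      contDiffOn_const.absolutelyContinuousOnInterval h1)
    convert! h2 using 1
    funext s
    exact hsol y s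
  have heac : AbsolutelyContinuousOnInterval (fun s : ℝ => Complex.exp (-z * s)) y x := by
    refine ContDiffOn.absolutelyContinuousOnInterval (ContDiff.contDiffOn ?_)
    exact (contDiff_const.mul Complex.ofRealCLM.contDiff).cexp
  have hac := (heac.smul hfac).sub
    (absolutelyContinuousOnInterval_intervalIntegral_complex hk y x)
  obtain ⟨C, hC⟩ := hac.const_of_ae_hasDerivAt_zero (by
    filter_upwards [(hg y x).ae_hasDerivAt_integral, (hk y x).ae_hasDerivAt_integral]
      with s h1 h2 hs
    have h3 := (h1 hs y Set.left_mem_uIcc).const_add (f y)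
    have h3' : HasDerivAt f (z * f s + h s) s := by
      convert! h3 using 1
      funext s
      exact hsol y s
    have h4 : HasDerivAt (fun s : ℝ => Complex.exp (-z * s)) (Complex.exp (-z * s) * -z) s := by
      have : HasDerivAt (fun s : ℝ => -z * (s : ℂ)) (-z) s := by
        simpa using (Complex.ofRealCLM.hasDerivAt (x := s)).const_mul (-z)
      exact this.cexp
    refine ((h4.mul h3').sub (h2 hs y Set.left_mem_uIcc)).congr_deriv ?_
    ring)
  have e1 := hC y Set.left_mem_uIcc
  have e2 := hC x Set.right_mem_uIcc
  simp only [Pi.sub_apply, smul_eq_mul, intervalIntegral.integral_same,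
    sub_zero] at e1 e2
  rw [← e1, sub_eq_iff_eq_add] at e2
  exact e2

section

variable {N : ℕ} {L : ℝ → Matrix (Fin N) (Fin N) ℂ}

theorem intervalIntegrable_pi {f : ℝ → Fin N → ℂ} {a b : ℝ}
    (h : ∀ i, IntervalIntegrable (fun x => f x i) volume a b) :
    IntervalIntegrable f volume a b :=
  ⟨Integrable.of_eval fun i => (h i).1, Integrable.of_eval fun i => (h i).2⟩

theorem intervalIntegral_apply {f : ℝ → Fin N → ℂ} {a b : ℝ}
    (h : IntervalIntegrable f volume a b) (i : Fin N) :
    (∫ x in a..b, f x) i = ∫ x in a..b, f x i :=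
  ((ContinuousLinearMap.proj (R := ℂ) (φ := fun _ : Fin N => ℂ) i).intervalIntegral_comp_comm
    h).symm

theorem intervalIntegrable_mulVec
    (hL : ∀ i j a b, IntervalIntegrable (fun x => L x i j) volume a b)
    {u : ℝ → Fin N → ℂ} (hu : Continuous u) (a b : ℝ) :
    IntervalIntegrable (fun x => (L x).mulVec (u x)) volume a b := by
  refine intervalIntegrable_pi fun i => ?_
  have : (fun x => (L x).mulVec (u x) i) = ∑ j, fun x => L x i j * u x j := by
    funext x
    simp [Matrix.mulVec, dotProduct]
  rw [this]
  exact IntervalIntegrable.sum _ fun j _ =>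
    (hL i j a b).mul_continuousOn ((continuous_apply j).comp hu).continuousOn

/-- The space of solutions of `u' = L(x) u`. -/
def solutionSpace (L : ℝ → Matrix (Fin N) (Fin N) ℂ)
    (hL : ∀ i j a b, IntervalIntegrable (fun x => L x i j) volume a b) :
    Submodule ℂ (ℝ → Fin N → ℂ) where
  carrier := {u | IsSolV N L u}
  zero_mem' := by
    refine ⟨continuous_zero, fun x₀ x => ?_⟩
    simp
  add_mem' := by
    rintro u v ⟨hu, hu'⟩ ⟨hv, hv'⟩
    refine ⟨hu.add hv, fun x₀ x => ?_⟩
    simp only [Pi.add_apply, Matrix.mulVec_add]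
    rw [intervalIntegral.integral_add (intervalIntegrable_mulVec hL hu _ _)
      (intervalIntegrable_mulVec hL hv _ _), hu' x₀ x, hv' x₀ x]
    abel
  smul_mem' := by
    rintro c u ⟨hu, hu'⟩
    refine ⟨hu.const_smul c, fun x₀ x => ?_⟩
    simp only [Pi.smul_apply, Matrix.mulVec_smul]
    rw [intervalIntegral.integral_smul, hu' x₀ x, smul_add]

theorem IsSolV.mulVec (hL : ∀ i j a b, IntervalIntegrable (fun x => L x i j) volume a b)
    {M : ℝ → Matrix (Fin N) (Fin N) ℂ} {Q : Matrix (Fin N) (Fin N) ℂ}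
    (hQ : ∀ x, Q * L x = M x * Q) {u : ℝ → Fin N → ℂ} (hu : IsSolV N L u) :
    IsSolV N M (fun x => Q.mulVec (u x)) := by
  have hQc : Continuous fun v : Fin N → ℂ => Q.mulVec v := by fun_prop
  refine ⟨hQc.comp hu.1, fun x₀ x => ?_⟩
  have h := (LinearMap.toContinuousLinearMap Q.mulVecLin).intervalIntegral_comp_comm
    (intervalIntegrable_mulVec hL hu.1 x₀ x)
  simp only [LinearMap.coe_toContinuousLinearMap', Matrix.mulVecLin_apply] at h
  simp only [Matrix.mulVec_mulVec, ← hQ] at h ⊢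
  rw [h, ← Matrix.mulVec_add, ← hu.2 x₀ x]

theorem IsSolV.comp_neg {u : ℝ → Fin N → ℂ} (hu : IsSolV N L u) :
    IsSolV N (fun x => -L (-x)) (fun x => u (-x)) := by
  refine ⟨hu.1.comp continuous_neg, fun x₀ x => ?_⟩
  simp only [Matrix.neg_mulVec]
  rw [intervalIntegral.integral_neg,
    intervalIntegral.integral_comp_neg (fun y => (L y).mulVec (u y)),
    ← intervalIntegral.integral_symm]
  exact hu.2 (-x₀) (-x)

theorem norm_mulVec_apply_le (A : Matrix (Fin N) (Fin N) ℂ) (v : Fin N → ℂ) (i : Fin N) :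
    ‖A.mulVec v i‖ ≤ (∑ k, ∑ j, ‖A k j‖) * ‖v‖ := by
  calc ‖A.mulVec v i‖ = ‖∑ j, A i j * v j‖ := rfl
    _ ≤ ∑ j, ‖A i j * v j‖ := norm_sum_le _ _
    _ ≤ ∑ j, ‖A i j‖ * ‖v‖ := by
        refine Finset.sum_le_sum fun j _ => ?_
        rw [norm_mul]
        gcongr
        exact norm_le_pi_norm v j
    _ = (∑ j, ‖A i j‖) * ‖v‖ := by rw [Finset.sum_mul]
    _ ≤ _ := by
        refine mul_le_mul_of_nonneg_right ?_ (norm_nonneg _)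
        exact Finset.single_le_sum (f := fun k => ∑ j, ‖A k j‖)
          (fun k _ => Finset.sum_nonneg fun j _ => norm_nonneg _) (Finset.mem_univ i)

theorem norm_mulVec_le (A : Matrix (Fin N) (Fin N) ℂ) (v : Fin N → ℂ) :
    ‖A.mulVec v‖ ≤ (∑ k, ∑ j, ‖A k j‖) * ‖v‖ :=
  (pi_norm_le_iff_of_nonneg (mul_nonneg
    (Finset.sum_nonneg fun _ _ => Finset.sum_nonneg fun _ _ => norm_nonneg _)
    (norm_nonneg _))).2 fun i => norm_mulVec_apply_le A v i

/-- A solution vanishing at one point vanishes identically. -/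
theorem IsSolV.eq_zero_of_apply_eq_zero
    (hL : ∀ i j a b, IntervalIntegrable (fun x => L x i j) volume a b)
    {u : ℝ → Fin N → ℂ} (hu : IsSolV N L u) {x₀ : ℝ} (h0 : u x₀ = 0) (x : ℝ) : u x = 0 := by
  have hlam (a b : ℝ) : IntervalIntegrable (fun x => ∑ k, ∑ j, ‖L x k j‖) volume a b := by
    have : (fun x => ∑ k, ∑ j, ‖L x k j‖) = ∑ k, ∑ j, fun x => ‖L x k j‖ := by
      funext x
      simp
    rw [this]
    exact IntervalIntegrable.sum _ fun k _ => IntervalIntegrable.sum _ fun j _ =>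
      (hL k j a b).norm
  suffices h : {x | u x = 0} = Set.univ by
    have : x ∈ {x | u x = 0} := h ▸ Set.mem_univ x
    exact this
  refine IsClopen.eq_univ ⟨isClosed_eq hu.1 continuous_const, ?_⟩ ⟨x₀, h0⟩
  rw [Metric.isOpen_iff]
  intro y hy
  have hcont := (intervalIntegral.continuous_primitive hlam y).tendsto y
  rw [intervalIntegral.integral_same] at hcont
  obtain ⟨δ, hδ, hδ'⟩ := Metric.eventually_nhds_iff_ball.1
    (hcont.eventually (Metric.ball_mem_nhds 0 (by norm_num : (0:ℝ) < 1 / 2)))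
  refine ⟨δ / 2, by positivity, ?_⟩
  obtain ⟨m, hm, hmax⟩ := (isCompact_closedBall y (δ / 2)).exists_isMaxOn
    ⟨y, Metric.mem_closedBall_self (by positivity)⟩ hu.1.norm.continuousOn
  have hseg {s : ℝ} (hs : s ∈ Set.uIoc y m) : s ∈ Metric.closedBall y (δ / 2) :=
    (convex_closedBall y (δ / 2)).segment_subset (Metric.mem_closedBall_self (by positivity)) hm
      (segment_eq_uIcc y m ▸ Set.uIoc_subset_uIcc hs)
  have key : ‖u m‖ ≤ 1 / 2 * ‖u m‖ := by
    have h1 : u m = ∫ s in y..m, (L s).mulVec (u s) := by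
      have hy' : u y = 0 := hy
      simpa [hy'] using hu.2 y m
    have h2 : ‖∫ s in y..m, (L s).mulVec (u s)‖ ≤
        |∫ s in y..m, (∑ k, ∑ j, ‖L s k j‖) * ‖u m‖| := by
      refine intervalIntegral.norm_integral_le_abs_of_norm_le ?_ ((hlam y m).mul_const _)
      refine (ae_restrict_iff' measurableSet_uIoc).2 (Eventually.of_forall fun s hs => ?_)
      refine (norm_mulVec_le _ _).trans ?_
      gcongr
      exact hmax (hseg hs)
    rw [← h1, intervalIntegral.integral_mul_const, abs_mul, abs_norm] at h2
    refine h2.trans ?_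
    gcongr
    have := hδ' m (Metric.closedBall_subset_ball (by linarith) hm)
    rw [dist_zero_right, Real.norm_eq_abs] at this
    exact this.le
  intro s hs
  have hs' : ‖u s‖ ≤ ‖u m‖ := hmax (Metric.ball_subset_closedBall hs)
  exact norm_le_zero_iff.1 (by linarith)

theorem intervalIntegrable_add_apply {R : ℝ → Matrix (Fin N) (Fin N) ℂ}
    (hR : ∀ i j, Integrable fun x => R x i j) (A : Matrix (Fin N) (Fin N) ℂ) (i j : Fin N)
    (a b : ℝ) : IntervalIntegrable (fun x => (A + R x) i j) volume a b :=
  intervalIntegrable_const.add (hR i j).intervalIntegrable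

theorem integrable_sum_norm {R : ℝ → Matrix (Fin N) (Fin N) ℂ}
    (hR : ∀ i j, Integrable fun x => R x i j) :
    Integrable fun x => ∑ k, ∑ j, ‖R x k j‖ :=
  integrable_finsetSum _ fun k _ => integrable_finsetSum _ fun j _ => (hR k j).norm

theorem weighted_norm_apply_le {ζ : Fin N → ℂ} {R : ℝ → Matrix (Fin N) (Fin N) ℂ}
    (hR : ∀ i j, Integrable fun x => R x i j) {c : ℝ → Fin N → ℂ}
    (hc : IsSolV N (fun x => Matrix.diagonal ζ + R x) c) {a x₀ M : ℝ}
    (hM : ∀ x ≤ x₀, Real.exp (-a * x) * ‖c x‖ ≤ M)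
    (hρ : ∫ x in Set.Iic x₀, ∑ k, ∑ j, ‖R x k j‖ ≤ 1 / 2) {k : Fin N} {x y : ℝ}
    (hx : x ≤ x₀) (hy : y ≤ x₀) (hxy : ((ζ k).re - a) * (x - y) ≤ 0) :
    Real.exp (-a * x) * ‖c x k‖ ≤ Real.exp (-a * y) * ‖c y k‖ + M / 2 := by
  have hM0 : 0 ≤ M := (by positivity : 0 ≤ Real.exp (-a * x₀) * ‖c x₀‖).trans (hM x₀ le_rfl)
  have hRi (a b : ℝ) := intervalIntegrable_mulVec (L := R)
    (fun i j a b => (hR i j).intervalIntegrable) hc.1 a b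
  have hRk (a b : ℝ) : IntervalIntegrable (fun s => (R s).mulVec (c s) k) volume a b :=
    ⟨(hRi a b).1.eval k, (hRi a b).2.eval k⟩
  have hvar := exp_mul_eq_add_integral (f := fun s => c s k) (h := fun s => (R s).mulVec (c s) k)
    (z := ζ k) ((continuous_apply k).comp hc.1) hRk (fun s t => by
      have h := congrFun (hc.2 s t) k
      rw [Pi.add_apply, intervalIntegral_apply (intervalIntegrable_mulVec
        (L := fun x => Matrix.diagonal ζ + R x) (fun i j a b => intervalIntegrable_add_apply hR _ i j a b) hc.1 s t)] at h
      simpa [Matrix.add_mulVec, Matrix.mulVec_diagonal] using h) y x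
  set σ := (ζ k).re with hσ
  have hnorm (s : ℝ) : ‖Complex.exp (-ζ k * s)‖ = Real.exp (-σ * s) := by
    simp [Complex.norm_exp, hσ]
  have hint : ‖∫ s in y..x, Complex.exp (-ζ k * s) * (R s).mulVec (c s) k‖ ≤
      1 / 2 * (M * Real.exp (-(σ - a) * x)) := by
    have h1 : ‖∫ s in y..x, Complex.exp (-ζ k * s) * (R s).mulVec (c s) k‖ ≤
        |∫ s in y..x, (∑ k, ∑ j, ‖R s k j‖) * (M * Real.exp (-(σ - a) * x))| := by
      refine intervalIntegral.norm_integral_le_abs_of_norm_le ?_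
        ((integrable_sum_norm hR).intervalIntegrable.mul_const _)
      refine (ae_restrict_iff' measurableSet_uIoc).2 (Eventually.of_forall fun s hs => ?_)
      have hsx : s ≤ x₀ := (Set.uIoc_subset_uIcc hs).2.trans (by simp [hx, hy])
      have hsxy : (σ - a) * (x - s) ≤ 0 := by
        have hs' := Set.uIoc_subset_uIcc hs
        rcases le_total y x with h | h
        · rw [Set.uIcc_of_le h] at hs'
          rcases h.eq_or_lt with h' | h'
          · have : x - s = 0 := by linarith [hs'.1, hs'.2]
            simp [this]
          · have : σ - a ≤ 0 := by nlinarith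
            exact mul_nonpos_of_nonpos_of_nonneg this (by linarith [hs'.2])
        · rw [Set.uIcc_of_ge h] at hs'
          rcases h.eq_or_lt with h' | h'
          · have : x - s = 0 := by linarith [hs'.1, hs'.2]
            simp [this]
          · have : 0 ≤ σ - a := by nlinarith
            exact mul_nonpos_of_nonneg_of_nonpos this (by linarith [hs'.1])
      rw [norm_mul, hnorm]
      have hρ0 : 0 ≤ ∑ k, ∑ j, ‖R s k j‖ := by positivity
      calc Real.exp (-σ * s) * ‖(R s).mulVec (c s) k‖
          ≤ Real.exp (-σ * s) * ((∑ k, ∑ j, ‖R s k j‖) * ‖c s‖) := by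
            gcongr
            exact norm_mulVec_apply_le _ _ _
        _ = (∑ k, ∑ j, ‖R s k j‖) *
              ((Real.exp (-a * s) * ‖c s‖) * Real.exp (-(σ - a) * s)) := by
            have : Real.exp (-σ * s) = Real.exp (-a * s) * Real.exp (-(σ - a) * s) := by
              rw [← Real.exp_add]
              ring_nf
            rw [this]
            ring
        _ ≤ _ := by
            refine mul_le_mul_of_nonneg_left ?_ hρ0
            refine mul_le_mul (hM s hsx) (Real.exp_le_exp.2 ?_) (Real.exp_nonneg _) hM0
            linarith
    refine h1.trans ?_
    rw [intervalIntegral.integral_mul_const, abs_mul,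
      abs_of_nonneg (a := M * Real.exp (-(σ - a) * x)) (by positivity)]
    refine mul_le_mul_of_nonneg_right (le_trans ?_ hρ) (by positivity)
    rw [← Real.norm_eq_abs, intervalIntegral.norm_integral_eq_norm_integral_uIoc,
      Real.norm_of_nonneg (by positivity)]
    refine setIntegral_mono_set (integrable_sum_norm hR).integrableOn
      (Eventually.of_forall fun s => ?_)
      (LE.le.eventuallyLE ?_)
    · simp only [Pi.zero_apply]
      positivity
    · exact fun s hs => (Set.uIoc_subset_uIcc hs).2.trans (by simp [hx, hy])
  have h2 : Real.exp (-σ * x) * ‖c x k‖ ≤ Real.exp (-σ * y) * ‖c y k‖ +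
      1 / 2 * (M * Real.exp (-(σ - a) * x)) := by
    rw [← hnorm, ← hnorm, ← norm_mul, ← norm_mul]
    calc _ = _ := congrArg norm hvar
      _ ≤ _ := (norm_add_le _ _).trans (by gcongr)
  have e1 : Real.exp (-a * x) = Real.exp ((σ - a) * x) * Real.exp (-σ * x) := by
    rw [← Real.exp_add]
    ring_nf
  have e2 : Real.exp ((σ - a) * x) * Real.exp (-σ * y) ≤ Real.exp (-a * y) := by
    rw [← Real.exp_add]
    refine Real.exp_le_exp.2 ?_
    linarith
  have e3 : Real.exp ((σ - a) * x) * Real.exp (-(σ - a) * x) = 1 := by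
    rw [← Real.exp_add, neg_mul, add_neg_cancel, Real.exp_zero]
  calc Real.exp (-a * x) * ‖c x k‖
      = Real.exp ((σ - a) * x) * (Real.exp (-σ * x) * ‖c x k‖) := by rw [e1, mul_assoc]
    _ ≤ Real.exp ((σ - a) * x) * (Real.exp (-σ * y) * ‖c y k‖ +
          1 / 2 * (M * Real.exp (-(σ - a) * x))) := by gcongr
    _ = (Real.exp ((σ - a) * x) * Real.exp (-σ * y)) * ‖c y k‖ +
          M / 2 * (Real.exp ((σ - a) * x) * Real.exp (-(σ - a) * x)) := by ring
    _ ≤ _ := by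
        rw [e3, mul_one]
        gcongr

/-- A solution that is `o(e^{a x})` at `-∞` is determined by the coordinates, at a point far
enough to the left, along the eigenvalues of real part larger than `a`. -/
theorem IsSolV.eq_zero_of_tendsto_atBot {ζ : Fin N → ℂ} {R : ℝ → Matrix (Fin N) (Fin N) ℂ}
    (hR : ∀ i j, Integrable fun x => R x i j) {c : ℝ → Fin N → ℂ}
    (hc : IsSolV N (fun x => Matrix.diagonal ζ + R x) c) {a x₀ : ℝ}
    (hlim : Tendsto (fun x => Real.exp (-a * x) * ‖c x‖) atBot (𝓝 0))
    (hρ : ∫ x in Set.Iic x₀, ∑ k, ∑ j, ‖R x k j‖ ≤ 1 / 2)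
    (h0 : ∀ k, a < (ζ k).re → c x₀ k = 0) (x : ℝ) : c x = 0 := by
  set b : ℝ → ℝ := fun x => Real.exp (-a * x) * ‖c x‖ with hb
  have hb0 (x : ℝ) : 0 ≤ b x := by positivity
  have hbc : Continuous b := by
    have := hc.1
    fun_prop
  obtain ⟨A, hA⟩ := eventually_atBot.1 (hlim.eventually_le_const one_pos)
  obtain ⟨B, hB⟩ := (isCompact_Icc (a := A) (b := x₀)).exists_bound_of_continuousOn
    hbc.continuousOn
  have hbdd : BddAbove (b '' Set.Iic x₀) := by
    refine ⟨max 1 B, ?_⟩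
    rintro _ ⟨y, hy, rfl⟩
    rcases le_total y A with h | h
    · exact (hA y h).trans (le_max_left _ _)
    · exact ((le_abs_self _).trans (hB y ⟨h, hy⟩)).trans (le_max_right _ _)
  set M := sSup (b '' Set.Iic x₀) with hMdef
  have hM (x : ℝ) (hx : x ≤ x₀) : b x ≤ M := le_csSup hbdd ⟨x, hx, rfl⟩
  have hM0 : 0 ≤ M := (hb0 x₀).trans (hM x₀ le_rfl)
  have hhalf (x : ℝ) (hx : x ≤ x₀) : b x ≤ M / 2 := by
    have hk (k : Fin N) : Real.exp (-a * x) * ‖c x k‖ ≤ M / 2 := by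
      rcases le_or_gt (ζ k).re a with h | h
      · have hlim' : Tendsto (fun y => b y + M / 2) atBot (𝓝 (M / 2)) := by
          simpa using hlim.add_const (M / 2)
        refine ge_of_tendsto hlim' ?_
        filter_upwards [eventually_le_atBot x] with y hy
        refine (weighted_norm_apply_le hR hc hM hρ hx (hy.trans hx)
          (mul_nonpos_of_nonpos_of_nonneg (by linarith) (by linarith))).trans ?_
        simp only [hb]
        gcongr
        exact norm_le_pi_norm _ _
      · have := weighted_norm_apply_le hR hc hM hρ (k := k) hx le_rfl
          (mul_nonpos_of_nonneg_of_nonpos (by linarith) (by linarith))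
        simpa [h0 k h] using this
    have h1 : ‖c x‖ ≤ M / 2 / Real.exp (-a * x) :=
      (pi_norm_le_iff_of_nonneg (by positivity)).2 fun k => by
        rw [le_div_iff₀' (Real.exp_pos _)]
        exact hk k
    rwa [le_div_iff₀' (Real.exp_pos _)] at h1
  have hMle : M ≤ M / 2 := by
    refine csSup_le ⟨_, x₀, Set.mem_Iic.2 le_rfl, rfl⟩ ?_
    rintro _ ⟨y, hy, rfl⟩
    exact hhalf y hy
  refine hc.eq_zero_of_apply_eq_zero
    (fun i j a b => intervalIntegrable_add_apply hR _ i j a b) (x₀ := x₀) ?_ x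
  have h1 : b x₀ = 0 := le_antisymm ((hM x₀ le_rfl).trans (by linarith)) (hb0 x₀)
  simpa [hb, (Real.exp_pos _).ne'] using h1

theorem tendsto_exp_mul_norm_of_lt {z : ℂ} {a : ℝ} (ha : a < z.re) {u : ℝ → Fin N → ℂ}
    {p : Fin N → ℂ}
    (hu : Tendsto (fun x : ℝ => Complex.exp (-z * x) • u x) atBot (𝓝 p)) :
    Tendsto (fun x => Real.exp (-a * x) * ‖u x‖) atBot (𝓝 0) := by
  have h1 : Tendsto (fun x : ℝ => Real.exp ((z.re - a) * x)) atBot (𝓝 0) :=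
    Real.tendsto_exp_atBot.comp (tendsto_id.const_mul_atBot (by linarith))
  have h2 := h1.mul hu.norm
  rw [zero_mul] at h2
  refine h2.congr fun x => ?_
  rw [norm_smul, Complex.norm_exp, ← mul_assoc, ← Real.exp_add]
  congr 2
  simp
  ring

theorem tendsto_exp_mul_norm_sum {ι : Type*} (s : Finset ι) {a : ℝ} {u : ι → ℝ → Fin N → ℂ}
    (hu : ∀ i ∈ s, Tendsto (fun x => Real.exp (-a * x) * ‖u i x‖) atBot (𝓝 0)) :
    Tendsto (fun x => Real.exp (-a * x) * ‖∑ i ∈ s, u i x‖) atBot (𝓝 0) := by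
  have h := tendsto_finsetSum s hu
  rw [Finset.sum_const_zero] at h
  refine squeeze_zero (fun x => by positivity) (fun x => ?_) h
  rw [← Finset.mul_sum]
  gcongr
  exact norm_sum_le _ _

/-- Solutions with asymptotics `e^{ζ_k x} e_k` at `-∞` are linearly independent. -/
theorem eq_zero_of_sum_smul_eq_zero {ζ : Fin N → ℂ} {K : Set (Fin N)} [Fintype K]
    {u : Fin N → ℝ → Fin N → ℂ}
    (hu : ∀ k ∈ K, Tendsto (fun x : ℝ => Complex.exp (-ζ k * x) • u k x) atBot
      (𝓝 (Pi.single k 1)))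
    {c : K → ℂ} (hc : ∀ x, ∑ k, c k • u k x = 0) : c = 0 := by
  classical
  by_contra hne
  obtain ⟨k₁, hk₁⟩ := Function.ne_iff.1 hne
  obtain ⟨k₀, hk₀, hmin⟩ := Finset.exists_min_image (Finset.univ.filter fun k => c k ≠ 0)
    (fun k : K => (ζ k).re) ⟨k₁, by simpa using hk₁⟩
  have hk₀' : c k₀ ≠ 0 := by simpa using hk₀
  have hterm (k : K) : Tendsto (fun x : ℝ => Complex.exp (-ζ k₀ * x) * (c k * u k x k₀)) atBot
      (𝓝 (if k = k₀ then c k₀ else 0)) := by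
    have hk := (continuous_apply (k₀ : Fin N)).continuousAt.tendsto.comp (hu k k.2)
    simp only [Function.comp_def, Pi.smul_apply, smul_eq_mul] at hk
    split_ifs with h
    · subst h
      have := hk.const_mul (c k)
      rw [Pi.single_eq_same, mul_one] at this
      refine this.congr fun x => ?_
      ring
    · by_cases hck : c k = 0
      · simp [hck]
      have hle := hmin k (by simpa using hck)
      have hne' : (k₀ : Fin N) ≠ k := fun h' => h (Subtype.ext h'.symm)
      rw [Pi.single_eq_of_ne hne'] at hk
      have h3 := (hk.const_mul (c k)).norm
      rw [mul_zero, norm_zero] at h3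
      refine squeeze_zero_norm' ?_ h3
      filter_upwards [eventually_le_atBot 0] with x hx
      have : Complex.exp (-ζ k₀ * x) = Complex.exp ((ζ k - ζ k₀) * x) * Complex.exp (-ζ k * x) := by
        rw [← Complex.exp_add]
        ring_nf
      rw [this, show Complex.exp ((ζ k - ζ k₀) * x) * Complex.exp (-ζ k * x) *
        (c k * u k x k₀) = Complex.exp ((ζ k - ζ k₀) * x) *
        (c k * (Complex.exp (-ζ k * x) * u k x k₀)) by ring, norm_mul]
      refine mul_le_of_le_one_left (norm_nonneg _) ?_
      rw [Complex.norm_exp, Real.exp_le_one_iff]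
      simp only [Complex.mul_re, Complex.sub_re, Complex.ofReal_re, Complex.ofReal_im, mul_zero,
        sub_zero]
      exact mul_nonpos_of_nonneg_of_nonpos (by linarith) hx
  have hsum := tendsto_finsetSum Finset.univ fun k _ => hterm k
  rw [Finset.sum_ite_eq' Finset.univ k₀, if_pos (Finset.mem_univ _)] at hsum
  have hz : (fun x : ℝ => ∑ k, Complex.exp (-ζ k₀ * x) * (c k * u k x k₀)) = fun _ => 0 := by
    funext x
    have := congrFun (hc x) k₀
    rw [← Finset.mul_sum]
    simp only [Finset.sum_apply, Pi.smul_apply, smul_eq_mul, Pi.zero_apply] at this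
    rw [this, mul_zero]
  rw [hz] at hsum
  exact hk₀' (tendsto_nhds_unique tendsto_const_nhds hsum).symm

theorem exists_eq_sum_of_diagonal {ζ : Fin N → ℂ} {R : ℝ → Matrix (Fin N) (Fin N) ℂ}
    (hR : ∀ i j, Integrable fun x => R x i j) {a : ℝ} {u : Fin N → ℝ → Fin N → ℂ}
    (husol : ∀ k, a < (ζ k).re → IsSolV N (fun x => Matrix.diagonal ζ + R x) (u k))
    (hu : ∀ k, a < (ζ k).re → Tendsto (fun x : ℝ => Complex.exp (-ζ k * x) • u k x) atBot
      (𝓝 (Pi.single k 1)))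
    {w : ℝ → Fin N → ℂ} (hw : IsSolV N (fun x => Matrix.diagonal ζ + R x) w)
    (hlim : Tendsto (fun x => Real.exp (-a * x) * ‖w x‖) atBot (𝓝 0)) :
    ∃ c : Fin N → ℂ, (∀ k, c k ≠ 0 → a < (ζ k).re) ∧ ∀ x, w x = ∑ k, c k • u k x := by
  classical
  have hL (i j : Fin N) (s t : ℝ) :=
    intervalIntegrable_add_apply hR (Matrix.diagonal ζ) i j s t
  obtain ⟨x₀, hx₀⟩ : ∃ x₀, ∫ x in Set.Iic x₀, ∑ k, ∑ j, ‖R x k j‖ ≤ 1 / 2 :=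
    ((tendsto_integral_Iic_zero (f := fun x => ∑ k, ∑ j, ‖R x k j‖)
      tendsto_id).eventually_le_const (by norm_num)).exists
  let K : Set (Fin N) := {k | a < (ζ k).re}
  have hcomb_sol (c : K → ℂ) :
      IsSolV N (fun x => Matrix.diagonal ζ + R x) (fun x => ∑ k, c k • u k x) := by
    have : ∑ k, c k • u k ∈ solutionSpace _ hL :=
      Submodule.sum_mem _ fun k _ => Submodule.smul_mem _ _ (husol k k.2)
    convert! this using 1
    funext x
    simp
  have hcomb_lim (c : K → ℂ) :
      Tendsto (fun x => Real.exp (-a * x) * ‖∑ k, c k • u k x‖) atBot (𝓝 0) := by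
    refine tendsto_exp_mul_norm_sum _ fun k _ => ?_
    have := (tendsto_exp_mul_norm_of_lt k.2 (hu k k.2)).const_mul ‖c k‖
    rw [mul_zero] at this
    refine this.congr fun x => ?_
    rw [norm_smul]
    ring
  let T : (K → ℂ) →ₗ[ℂ] (K → ℂ) :=
    { toFun := fun c k => (∑ l, c l • u l x₀) k
      map_add' := fun c d => by
        funext k
        simp [add_mul, Finset.sum_add_distrib]
      map_smul' := fun c d => by
        funext k
        simp [Finset.mul_sum, mul_assoc] }
  have hinj : Function.Injective T := by
    rw [← LinearMap.ker_eq_bot, LinearMap.ker_eq_bot']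
    intro c hc
    refine eq_zero_of_sum_smul_eq_zero (fun k hk => hu k hk)
      fun x => (hcomb_sol c).eq_zero_of_tendsto_atBot hR (hcomb_lim c) hx₀ (fun k hk => ?_) x
    exact congrFun hc ⟨k, hk⟩
  obtain ⟨c, hc⟩ := LinearMap.injective_iff_surjective.1 hinj fun k => w x₀ k
  have hdiff : IsSolV N (fun x => Matrix.diagonal ζ + R x)
      (fun x => w x - ∑ k, c k • u k x) :=
    (solutionSpace _ hL).sub_mem hw (hcomb_sol c)
  have hdiff_lim :
      Tendsto (fun x => Real.exp (-a * x) * ‖w x - ∑ k, c k • u k x‖) atBot (𝓝 0) := by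
    have h := hlim.add (hcomb_lim c)
    rw [add_zero] at h
    refine squeeze_zero (fun x => by positivity) (fun x => ?_) h
    rw [← mul_add]
    gcongr
    exact norm_sub_le _ _
  have hzero (x : ℝ) := hdiff.eq_zero_of_tendsto_atBot hR hdiff_lim hx₀ (fun k hk => by
    have := congrFun hc ⟨k, hk⟩
    rw [Pi.sub_apply, sub_eq_zero]
    exact this.symm) x
  refine ⟨fun k => if h : k ∈ K then c ⟨k, h⟩ else 0, fun k hk => ?_, fun x => ?_⟩
  · by_contra h
    exact hk (dif_neg h)
  · rw [sub_eq_zero.1 (hzero x)]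
    refine Fintype.sum_of_injective _ Subtype.val_injective _ _ (fun k hk => ?_) fun k => ?_
    · have hk' : k ∉ K := by simpa using hk
      simp only [dif_neg hk', zero_smul]
    · simp only [dif_pos k.2]

/-- A solution that is `o(e^{a x})` at `-∞` is a linear combination of the solutions `u_k`
asymptotic to `e^{ζ_k x} p_k` at `-∞` with `Re ζ_k > a`. -/
theorem exists_eq_sum_of_tendsto_atBot {L₀ : Matrix (Fin N) (Fin N) ℂ} {ζ : Fin N → ℂ}
    {p : Fin N → Fin N → ℂ} (hdist : Function.Injective ζ)
    (heig : ∀ j, L₀.mulVec (p j) = ζ j • p j) (hp0 : ∀ j, p j ≠ 0)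
    {V : ℝ → Matrix (Fin N) (Fin N) ℂ}
    (hV : ∀ i j, Integrable fun x => V x i j) {a : ℝ} {u : Fin N → ℝ → Fin N → ℂ}
    (husol : ∀ k, a < (ζ k).re → IsSolV N (fun x => L₀ + V x) (u k))
    (hu : ∀ k, a < (ζ k).re → Tendsto (fun x : ℝ => Complex.exp (-ζ k * x) • u k x) atBot
      (𝓝 (p k)))
    {w : ℝ → Fin N → ℂ} (hw : IsSolV N (fun x => L₀ + V x) w)
    (hlim : Tendsto (fun x => Real.exp (-a * x) * ‖w x‖) atBot (𝓝 0)) :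
    ∃ c : Fin N → ℂ, (∀ k, c k ≠ 0 → a < (ζ k).re) ∧ ∀ x, w x = ∑ k, c k • u k x := by
  let P : Matrix (Fin N) (Fin N) ℂ := (Matrix.of p).transpose
  have hli : LinearIndependent ℂ p :=
    Module.End.eigenvectors_linearIndependent' (Matrix.toLin' L₀) ζ hdist p fun j =>
      ⟨Module.End.mem_eigenspace_iff.2 (by simpa using heig j), hp0 j⟩
  have hP : IsUnit P := by
    rw [← Matrix.linearIndependent_cols_iff_isUnit]
    exact hli
  have hPdet : IsUnit P.det := (Matrix.isUnit_iff_isUnit_det _).1 hP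
  have hPp (k : Fin N) : P.mulVec (Pi.single k 1) = p k := by
    rw [Matrix.mulVec_single_one]
    rfl
  have hQp (k : Fin N) : P⁻¹.mulVec (p k) = Pi.single k 1 := by
    rw [← hPp, Matrix.mulVec_mulVec, Matrix.nonsing_inv_mul _ hPdet, Matrix.one_mulVec]
  have hLP : L₀ * P = P * Matrix.diagonal ζ := by
    ext i j
    have := congrFun (heig j) i
    rw [Matrix.mul_diagonal]
    simpa [P, Matrix.mul_apply, Matrix.mulVec, dotProduct, mul_comm] using this
  let R : ℝ → Matrix (Fin N) (Fin N) ℂ := fun x => P⁻¹ * V x * P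
  have hR (i j : Fin N) : Integrable fun x => R x i j := by
    simp only [R, Matrix.mul_apply]
    exact integrable_finsetSum _ fun k _ => (integrable_finsetSum _ fun l _ =>
      (hV l k).const_mul _).mul_const _
  have hQ (x : ℝ) : P⁻¹ * (L₀ + V x) = (Matrix.diagonal ζ + R x) * P⁻¹ := by
    have h1 : Matrix.diagonal ζ = P⁻¹ * L₀ * P := by
      rw [Matrix.mul_assoc, hLP, ← Matrix.mul_assoc, Matrix.nonsing_inv_mul _ hPdet,
        Matrix.one_mul]
    rw [h1, ← Matrix.add_mul, ← Matrix.mul_add, Matrix.mul_assoc, Matrix.mul_nonsing_inv _ hPdet,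
      Matrix.mul_one]
  have hL (i j : Fin N) (s t : ℝ) := intervalIntegrable_add_apply hV L₀ i j s t
  obtain ⟨c, hc, hc'⟩ := exists_eq_sum_of_diagonal (ζ := ζ) hR (a := a)
    (u := fun k x => P⁻¹.mulVec (u k x)) (w := fun x => P⁻¹.mulVec (w x))
    (fun k hk => (husol k hk).mulVec hL hQ)
    (fun k hk => by
      have hcont : Continuous fun v : Fin N → ℂ => P⁻¹.mulVec v := by fun_prop
      have := (hcont.tendsto _).comp (hu k hk)
      rw [hQp] at this
      simpa only [Function.comp_def, Matrix.mulVec_smul] using this)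
    (hw.mulVec hL hQ) (by
      have h := hlim.const_mul (∑ k, ∑ j, ‖P⁻¹ k j‖)
      rw [mul_zero] at h
      refine squeeze_zero (fun x => by positivity) (fun x => ?_) h
      rw [mul_left_comm]
      gcongr
      exact norm_mulVec_le _ _)
  refine ⟨c, hc, fun x => ?_⟩
  have h := congrArg P.mulVec (hc' x)
  simpa only [← Matrix.mulVec_smul, ← Matrix.mulVec_sum, Matrix.mulVec_mulVec,
    Matrix.mul_nonsing_inv _ hPdet, Matrix.one_mulVec] using h

theorem tendsto_exp_mul_norm_sub {z : ℂ} {u v : ℝ → Fin N → ℂ} {p : Fin N → ℂ} {l : Filter ℝ}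
    (hu : Tendsto (fun x : ℝ => Complex.exp (-z * x) • u x) l (𝓝 p))
    (hv : Tendsto (fun x : ℝ => Complex.exp (-z * x) • v x) l (𝓝 p)) :
    Tendsto (fun x => Real.exp (-z.re * x) * ‖v x - u x‖) l (𝓝 0) := by
  have h := (hv.sub hu).norm
  rw [sub_self, norm_zero] at h
  refine h.congr fun x => ?_
  rw [← smul_sub, norm_smul, Complex.norm_exp]
  simp

theorem det_one_add_of_forall_lt {C : Matrix (Fin N) (Fin N) ℂ} {b : Fin N → ℝ}
    (hC : ∀ i j, C i j ≠ 0 → b j < b i) : (1 + C).det = 1 := by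
  have hC' (i j : Fin N) (h : b i ≤ b j) : C i j = 0 := by
    by_contra hne
    exact absurd (hC i j hne) h.not_gt
  have ht : (1 + C).transpose.BlockTriangular b := by
    intro i j hij
    have hne : j ≠ i := fun h => hij.ne (congrArg b h)
    simp [Matrix.one_apply_ne hne, hC' j i hij.le]
  rw [← Matrix.det_transpose, ht.det]
  refine Finset.prod_eq_one fun r _ => ?_
  have hone : (1 + C).transpose.toSquareBlock b r = 1 := by
    ext i j
    have : C j i = 0 := hC' _ _ (by rw [i.2, j.2])
    simp [Matrix.toSquareBlock_def, this, Matrix.one_apply, Subtype.ext_iff]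
  rw [hone, Matrix.det_one]

end

/-- two families of solutions `u_j` and `ũ_j` with the same asymptotics
`e^{−ζ_j x} u_j(x) → p_j` (as `x → −∞` for `j = 1,…,n`, as `x → +∞` for `j = n+1,…,N`)
have the same Wronskian: for every `x`,
`det{u₁(x),…,u_N(x)} = det{ũ₁(x),…,ũ_N(x)}`. -/
theorem statement_19 (N n : ℕ) (hN : 1 ≤ N) (hn : n ≤ N)
    (L₀ : Matrix (Fin N) (Fin N) ℂ) (ζ : Fin N → ℂ) (p : Fin N → Fin N → ℂ)
    (hdist : Function.Injective ζ)
    (heig : ∀ j, L₀.mulVec (p j) = ζ j • p j) (hp0 : ∀ j, p j ≠ 0)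
    (hre : ∀ j, (ζ j).re ≠ 0)
    (hpos : ∀ j : Fin N, (j : ℕ) < n → 0 < (ζ j).re)
    (hneg : ∀ j : Fin N, n ≤ (j : ℕ) → (ζ j).re < 0)
    (V : ℝ → Matrix (Fin N) (Fin N) ℂ)
    (hVmeas : ∀ i j : Fin N, Measurable fun x : ℝ => V x i j)
    (hVint : ∀ i j : Fin N, MeasureTheory.Integrable fun x : ℝ => V x i j)
    (u ut : Fin N → ℝ → Fin N → ℂ)
    (husol : ∀ j, IsSolV N (fun x => L₀ + V x) (u j))
    (hutsol : ∀ j, IsSolV N (fun x => L₀ + V x) (ut j))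
    (hasymm : ∀ j : Fin N, (j : ℕ) < n →
      Filter.Tendsto (fun x : ℝ => Complex.exp (-ζ j * x) • u j x)
        Filter.atBot (nhds (p j)) ∧
      Filter.Tendsto (fun x : ℝ => Complex.exp (-ζ j * x) • ut j x)
        Filter.atBot (nhds (p j)))
    (hasymp : ∀ j : Fin N, n ≤ (j : ℕ) →
      Filter.Tendsto (fun x : ℝ => Complex.exp (-ζ j * x) • u j x)
        Filter.atTop (nhds (p j)) ∧
      Filter.Tendsto (fun x : ℝ => Complex.exp (-ζ j * x) • ut j x)
        Filter.atTop (nhds (p j))) :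
    ∀ x : ℝ, (Matrix.of fun k j : Fin N => u j x k).det =
      (Matrix.of fun k j : Fin N => ut j x k).det := by
  have hL (i j : Fin N) (s t : ℝ) := intervalIntegrable_add_apply hVint L₀ i j s t
  have key (j : Fin N) : ∃ c : Fin N → ℂ, (∀ k, c k ≠ 0 → |(ζ j).re| < |(ζ k).re|) ∧
      ∀ x, ut j x - u j x = ∑ k, c k • u k x := by
    have hsol : IsSolV N (fun x => L₀ + V x) (fun x => ut j x - u j x) :=
      (solutionSpace _ hL).sub_mem (hutsol j) (husol j)
    rcases lt_or_ge (j : ℕ) n with hj | hj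
    · have hpj := hpos j hj
      have hlt (k : Fin N) (hk : (ζ j).re < (ζ k).re) : (k : ℕ) < n := by
        by_contra h
        linarith [hneg k (not_lt.1 h)]
      obtain ⟨c, hc, hc'⟩ := exists_eq_sum_of_tendsto_atBot hdist heig hp0 hVint
        (fun k _ => husol k) (fun k hk => (hasymm k (hlt k hk)).1) hsol
        (tendsto_exp_mul_norm_sub (hasymm j hj).1 (hasymm j hj).2)
      refine ⟨c, fun k hk => ?_, hc'⟩
      have := hc k hk
      rwa [abs_of_pos hpj, abs_of_pos (hpj.trans this)]
    · have hnj := hneg j hj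
      have hge (k : Fin N) (hk : (-ζ j).re < (-ζ k).re) : n ≤ (k : ℕ) := by
        by_contra h
        rw [Complex.neg_re, Complex.neg_re] at hk
        linarith [hpos k (not_le.1 h)]
      have hrefl {v : ℝ → Fin N → ℂ} (hv : IsSolV N (fun x => L₀ + V x) v) :
          IsSolV N (fun x => -L₀ + -V (-x)) (fun x => v (-x)) := by
        simpa only [neg_add] using hv.comp_neg
      have hreflim {k : Fin N} {v : ℝ → Fin N → ℂ}
          (hv : Tendsto (fun x : ℝ => Complex.exp (-ζ k * x) • v x) atTop (𝓝 (p k))) :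
          Tendsto (fun x : ℝ => Complex.exp (-(-ζ k) * x) • v (-x)) atBot (𝓝 (p k)) := by
        refine (hv.comp tendsto_neg_atBot_atTop).congr fun x => ?_
        simp
      obtain ⟨c, hc, hc'⟩ := exists_eq_sum_of_tendsto_atBot (L₀ := -L₀) (ζ := fun k => -ζ k)
        (V := fun x => -V (-x)) (u := fun k x => u k (-x)) (w := fun x => ut j (-x) - u j (-x))
        (neg_injective.comp hdist) (fun k => by rw [Matrix.neg_mulVec, heig, neg_smul]) hp0
        (fun i k => (hVint i k).comp_neg.neg) (fun k _ => hrefl (husol k))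
        (fun k hk => hreflim (hasymp k (hge k hk)).1) (hrefl hsol)
        (tendsto_exp_mul_norm_sub (hreflim (hasymp j hj).1) (hreflim (hasymp j hj).2))
      refine ⟨c, fun k hk => ?_, fun x => by simpa using hc' (-x)⟩
      have := hc k hk
      rw [Complex.neg_re, Complex.neg_re] at this
      rw [abs_of_neg hnj, abs_of_neg (by linarith)]
      exact this
  choose c hc hc' using key
  intro x
  have hmul : (Matrix.of fun k j : Fin N => ut j x k) =
      (Matrix.of fun k j : Fin N => u j x k) * (1 + Matrix.of fun k j : Fin N => c j k) := by
    ext i j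
    have h := congrFun (sub_eq_iff_eq_add'.1 (hc' j x)) i
    rw [Matrix.mul_add, Matrix.mul_one]
    simpa [Matrix.mul_apply, mul_comm] using h
  rw [hmul, Matrix.det_mul, det_one_add_of_forall_lt
    (C := Matrix.of fun k j : Fin N => c j k) (b := fun k => |(ζ k).re|)
    (fun i j h => hc j i h), mul_one]
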